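/- arXiv:1606.01459 — 2 statements merged into one kernel-verified Lean document; each statement's English description precedes it below -/
import Mathlib

section
/- For every integer k there exist elements D₁ and D₂ of the Enriques lattice Λ such that Q(D₁) = Q(D₂) = −2 and D₁ − D₂ = kΔ. -/
/-- The bilinear form `B(a,b) = (Σᵢ aᵢ)(Σⱼ bⱼ) − Σᵢ aᵢbᵢ` on `ℚ^10`. -/
def B (a b : Fin 10 → ℚ) : ℚ :=
  (∑ i, a i) * (∑ j, b j) - ∑ i, a i * b i

/-- The associated quadratic form `Q(a) = B(a,a)`. -/
def Q (a : Fin 10 → ℚ) : ℚ := B a a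

/-- Membership in the Enriques lattice
`Λ = {a ∈ ℚ^10 : 3aᵢ ∈ ℤ for all i, and aᵢ − aⱼ ∈ ℤ for all i, j}`. -/
def inLambda (a : Fin 10 → ℚ) : Prop :=
  (∀ i, ∃ n : ℤ, 3 * a i = (n : ℚ)) ∧ ∀ i j, ∃ n : ℤ, a i - a j = (n : ℚ)

/-- The standard basis vector `Eᵢ` of `ℚ^10`. -/
def E (i : Fin 10) : Fin 10 → ℚ := fun j => if j = i then 1 else 0

/-- The Fano class `Δ = (1/3)(E₁ + ⋯ + E₁₀)`. -/
def Δ : Fin 10 → ℚ := fun _ => 1 / 3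

/-- Adding integers to the entries of an integer multiple of `Δ` gives an element of `Λ`. -/
theorem inLambda_div_three_add (m : ℤ) (z : Fin 10 → ℤ) :
    inLambda fun i => (m : ℚ) / 3 + z i := by
  refine ⟨fun i => ⟨m + 3 * z i, ?_⟩, fun i j => ⟨z i - z j, ?_⟩⟩
  · push_cast
    ring
  · push_cast
    ring

/-- For every integer `k` there exist `D₁, D₂ ∈ Λ` with
`Q(D₁) = Q(D₂) = −2` and `D₁ − D₂ = kΔ`. -/
theorem exists_ulrich_pair (k : ℤ) :
    ∃ D₁ D₂ : Fin 10 → ℚ, inLambda D₁ ∧ inLambda D₂ ∧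
      Q D₁ = -2 ∧ Q D₂ = -2 ∧ D₁ - D₂ = (k : ℚ) • Δ := by
  let z : Fin 10 → ℤ := ![1 - k, -1 - k, -k, -k, -k, 0, 0, 0, 0, 0]
  refine ⟨fun i => ((2 * k : ℤ) : ℚ) / 3 + z i, fun i => (k : ℚ) / 3 + z i,
    inLambda_div_three_add _ z, inLambda_div_three_add _ z, ?_, ?_, ?_⟩
  · simp [Q, B, z, Fin.sum_univ_succ]
    ring
  · simp [Q, B, z, Fin.sum_univ_succ]
    ring
  · ext i
    simp only [Pi.sub_apply, Pi.smul_apply, smul_eq_mul, Δ]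
    push_cast
    ring
end

section
/- An element D of the Enriques lattice Λ satisfies Q(D − Δ) = −2 and Q(D − 2Δ) = −2 if and only if there is a permutation σ of the indices {1,…,10} such that the vector (D_{σ(1)},…,D_{σ(10)}) equals (2,1,1,1,0,0,0,0,0,0) or (1,1,1,1,1,1,−1,0,0,0). In other words, up to permutations of the Eᵢ, the Ulrich divisors for H = Δ are exactly D = 2E₁+E₂+E₃+E₄ and D = E₁+⋯+E₆−E₇. -/
/-- Two functions with fibers of the same cardinality differ by a permutation of the source. -/
theorem exists_perm_of_card_fiber_eq {α β : Type*} [Fintype α] [DecidableEq β] {f g : α → β}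
    (h : ∀ v, (Finset.univ.filter fun i => g i = v).card =
      (Finset.univ.filter fun i => f i = v).card) :
    ∃ σ : Equiv.Perm α, ∀ i, f (σ i) = g i := by
  have e : ∀ v, Nonempty ({i // g i = v} ≃ {i // f i = v}) := fun v =>
    ⟨Fintype.equivOfCardEq (by simpa only [Fintype.card_subtype] using h v)⟩
  exact ⟨Equiv.ofFiberEquiv fun v => (e v).some, fun i => Equiv.ofFiberEquiv_map _ i⟩

theorem ulrich_iff_sum_eq (D : Fin 10 → ℚ) :
    (Q (D - Δ) = -2 ∧ Q (D - (2 : ℚ) • Δ) = -2) ↔ ∑ i, D i = 5 ∧ ∑ i, D i ^ 2 = 7 := by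
  have hQ (c : ℚ) : Q (D - c • Δ) =
      (∑ i, D i) ^ 2 - ∑ i, D i ^ 2 - 6 * c * ∑ i, D i + 10 * c ^ 2 := by
    simp only [Q, B, Δ, Pi.sub_apply, Pi.smul_apply, smul_eq_mul, Fin.sum_univ_succ,
      Fin.sum_univ_zero]
    ring
  have h₁ := hQ 1
  rw [one_smul] at h₁
  rw [h₁, hQ 2]
  constructor
  · rintro ⟨h, h'⟩
    have hs : ∑ i, D i = 5 := by linarith
    rw [hs] at h
    exact ⟨hs, by linarith⟩
  · rintro ⟨hs, hq⟩
    rw [hs, hq]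
    norm_num

/-- An element of `Λ` whose coordinates have integral sum is integral. -/
theorem inLambda.exists_int {D : Fin 10 → ℚ} (hD : inLambda D) {s : ℤ} (hs : ∑ i, D i = s) :
    ∃ d : Fin 10 → ℤ, ∀ i, D i = d i := by
  obtain ⟨n, hn⟩ := hD.1 0
  choose m hm using fun i => hD.2 i 0
  have hsum : ∑ i, (D i - D 0) = ∑ i, (m i : ℚ) := Finset.sum_congr rfl fun i _ => hm i
  rw [Finset.sum_sub_distrib, hs] at hsum
  simp only [Finset.sum_const, Finset.card_univ, Fintype.card_fin, nsmul_eq_mul] at hsum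
  have hn' : D 0 = (s - ∑ i, m i - 3 * n : ℤ) := by
    push_cast at hsum ⊢
    linarith
  refine ⟨fun i => m i + (s - ∑ i, m i - 3 * n), fun i => ?_⟩
  have := hm i
  rw [Int.cast_add, ← hn']
  linarith

theorem card_fiber_of_sum_eq {d : Fin 10 → ℤ} (hs : ∑ i, d i = 5) (hq : ∑ i, d i ^ 2 = 7) :
    (∀ v, (Finset.univ.filter fun i =>
        (![2, 1, 1, 1, 0, 0, 0, 0, 0, 0] : Fin 10 → ℤ) i = v).card =
      (Finset.univ.filter fun i => d i = v).card) ∨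
    (∀ v, (Finset.univ.filter fun i =>
        (![1, 1, 1, 1, 1, 1, -1, 0, 0, 0] : Fin 10 → ℤ) i = v).card =
      (Finset.univ.filter fun i => d i = v).card) := by
  have hb (i : Fin 10) : -2 ≤ d i ∧ d i ≤ 2 := by
    have : d i ^ 2 ≤ 7 := hq ▸ Finset.single_le_sum (f := fun i => d i ^ 2)
      (fun j _ => sq_nonneg (d j)) (Finset.mem_univ i)
    constructor <;> nlinarith
  set N : ℤ → ℕ := fun v => (Finset.univ.filter fun i => d i = v).card with hN
  have key (f : ℤ → ℤ) : ∑ i, f (d i) =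
      f (-2) * N (-2) + f (-1) * N (-1) + f 0 * N 0 + f 1 * N 1 + f 2 * N 2 := by
    rw [← Finset.sum_fiberwise_of_maps_to (s := Finset.univ) (t := {-2, -1, 0, 1, 2}) (g := d)]
    · have hv (v : ℤ) : ∑ i with d i = v, f (d i) = f v * N v := by
        rw [Finset.sum_congr rfl fun i hi => by rw [(Finset.mem_filter.mp hi).2]]
        simp [hN, mul_comm]
      simp only [hv]
      simp [add_assoc]
    · intro i _
      have := hb i
      simp only [Finset.mem_insert, Finset.mem_singleton]
      omega
  have h0 := key fun _ => 1
  have h1 := key fun x => x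
  have h2 := key fun x => x ^ 2
  rw [hs] at h1
  rw [hq] at h2
  simp at h0 h1 h2
  have hout (v : ℤ) (hv : v < -2 ∨ 2 < v) : N v = 0 := by
    simp only [hN, Finset.card_eq_zero, Finset.filter_eq_empty_iff]
    intro i _ h
    have := hb i
    omega
  have hext (g : Fin 10 → ℤ) (hg : ∀ i, -2 ≤ g i ∧ g i ≤ 2)
      (hc : ∀ v ∈ ({-2, -1, 0, 1, 2} : Finset ℤ),
        (Finset.univ.filter fun i => g i = v).card = N v) (v : ℤ) :
      (Finset.univ.filter fun i => g i = v).card = N v := by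
    by_cases hv : v < -2 ∨ 2 < v
    · rw [hout v hv, Finset.card_eq_zero, Finset.filter_eq_empty_iff]
      intro i _ h
      have := hg i
      omega
    · refine hc v ?_
      simp only [Finset.mem_insert, Finset.mem_singleton]
      omega
  have hcases : (N (-2) = 0 ∧ N (-1) = 0 ∧ N 0 = 6 ∧ N 1 = 3 ∧ N 2 = 1) ∨
      (N (-2) = 0 ∧ N (-1) = 1 ∧ N 0 = 3 ∧ N 1 = 6 ∧ N 2 = 0) := by omega
  rcases hcases with ⟨c₁, c₂, c₃, c₄, c₅⟩ | ⟨c₁, c₂, c₃, c₄, c₅⟩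
  · left
    refine hext _ (by decide) ?_
    simp only [Finset.forall_mem_insert, Finset.mem_singleton, forall_eq,
      c₁, c₂, c₃, c₄, c₅]
    decide
  · right
    refine hext _ (by decide) ?_
    simp only [Finset.forall_mem_insert, Finset.mem_singleton, forall_eq,
      c₁, c₂, c₃, c₄, c₅]
    decide

/-- Up to permutations of the `Eᵢ`, the Ulrich divisors for `H = Δ` are exactly
`D = 2E₁+E₂+E₃+E₄` and `D = E₁+⋯+E₆−E₇`. -/
theorem ulrich_divisors_fano (D : Fin 10 → ℚ) (hD : inLambda D) :
    (Q (D - Δ) = -2 ∧ Q (D - (2 : ℚ) • Δ) = -2) ↔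
      ∃ σ : Equiv.Perm (Fin 10),
        (fun i => D (σ i)) = ![(2 : ℚ), 1, 1, 1, 0, 0, 0, 0, 0, 0] ∨
        (fun i => D (σ i)) = ![(1 : ℚ), 1, 1, 1, 1, 1, -1, 0, 0, 0] := by
  rw [ulrich_iff_sum_eq]
  constructor
  · rintro ⟨hs, hq⟩
    obtain ⟨d, hd⟩ := hD.exists_int (s := 5) (by simpa using hs)
    simp only [hd] at hs hq ⊢
    rcases card_fiber_of_sum_eq (d := d) (by exact_mod_cast hs) (by exact_mod_cast hq) with h | h
    all_goals
      obtain ⟨σ, hσ⟩ := exists_perm_of_card_fiber_eq h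
      refine ⟨σ, ?_⟩
    · left
      funext i
      rw [hσ]
      fin_cases i <;> simp
    · right
      funext i
      rw [hσ]
      fin_cases i <;> simp
  · rintro ⟨σ, h⟩
    rw [← Equiv.sum_comp σ, ← Equiv.sum_comp σ fun i => D i ^ 2]
    rcases h with h | h
    all_goals
      simp only [congrFun h]
      constructor <;> simp [Fin.sum_univ_succ] <;> norm_num
end
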